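/- arXiv:0905.0059 — 2 statements merged into one kernel-verified Lean document; each statement's English description precedes it below -/
import Mathlib

section
/- Suppose a ≥ 0, b ≥ 0 and c < 0 are integers, and there exist non-negative integers (e_1, …, e_r) solving the associated linear system for (f, g, a, b, c) (with e_0 = b and e_{r+1} = a). Then there exist s ∈ {0, 1, …, r}, integers a', b' with 0 ≤ a' ≤ a and 0 ≤ b' ≤ b, and non-negative integers (h_1, …, h_r) such that, setting h_0 = b' and h_{r+1} = a', one has h_{t−1} − b_t·h_t + h_{t+1} = δ_{ts} − f_t − (b_t − 2)·c for all 1 ≤ t ≤ r, where δ_{ts} = 1 if t = s and δ_{ts} = 0 otherwise (in particular, for s = 0 the right-hand side is −f_t − (b_t − 2)·c for all t). -/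
/-- Interval sums of `f_t - (b_t - 2)` are at most one. -/
theorem wunram_interval (r : ℕ) (i b ff T : ℕ → ℤ)
    (hpos : ∀ t, 1 ≤ t → t ≤ r → 1 ≤ i t)
    (hnn : ∀ t, 1 ≤ t → t ≤ r + 1 → 0 ≤ i t)
    (hrec : ∀ t, 1 ≤ t → t ≤ r → i (t - 1) = b t * i t - i (t + 1))
    (hT : ∀ t, 1 ≤ t → t ≤ r → T t = ff t * i t + T (t + 1))
    (hT0 : ∀ t, 1 ≤ t → t ≤ r + 1 → 0 ≤ T t)
    (hT1 : ∀ t, 1 ≤ t → t ≤ r + 1 → T t < i (t - 1)) :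
    ∀ k u : ℕ, 1 ≤ u → u + k ≤ r + 1 →
      (∑ j ∈ Finset.range k, (ff (u + j) - (b (u + j) - 2))) ≤ 1 ∧
      ((∑ j ∈ Finset.range k, (ff (u + j) - (b (u + j) - 2))) = 1 → i (u - 1) - i u ≤ T u) := by
  intro k
  induction k with
  | zero => intro u _ _; simp
  | succ k ih =>
    intro u hu hk
    obtain ⟨h1, h2⟩ := ih (u + 1) (by omega) (by omega)
    rw [Finset.sum_range_succ']
    have e : ∀ j, u + (j + 1) = u + 1 + j := fun j => by omega
    have e2 : (∑ j ∈ Finset.range k, (ff (u + (j + 1)) - (b (u + (j + 1)) - 2))) =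
        ∑ j ∈ Finset.range k, (ff (u + 1 + j) - (b (u + 1 + j) - 2)) :=
      Finset.sum_congr rfl (fun j _ => by rw [e j])
    rw [e2, show u + 0 = u from rfl]
    clear e2 e
    obtain ⟨S, hSd⟩ : ∃ S, S = ∑ j ∈ Finset.range k, (ff (u + 1 + j) - (b (u + 1 + j) - 2)) :=
      ⟨_, rfl⟩
    rw [← hSd] at h1 h2 ⊢
    have p := hpos u hu (by omega)
    have p' := hnn (u + 1) (by omega) (by omega)
    have rc := hrec u hu (by omega)
    have t := hT u hu (by omega)
    have t0 := hT0 (u + 1) (by omega) (by omega)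
    have t1 := hT1 u hu (by omega)
    rw [Nat.add_sub_cancel] at h2
    have y1 : ff u - (b u - 2) ≤ 1 := by
      by_contra hcon
      have : b u ≤ ff u := by omega
      nlinarith
    constructor
    · by_contra hcon
      have hS : S = 1 := by omega
      have hy : ff u = b u - 1 := by omega
      have := h2 hS
      rw [hy] at t
      nlinarith
    · intro hsum
      rcases (show (S = 1 ∧ ff u = b u - 2) ∨ ff u = b u - 1 by omega) with ⟨hS, hy⟩ | hy
      · have := h2 hS
        rw [hy] at t
        nlinarith
      · rw [hy] at t
        nlinarith

/-- Once the sequence leaves zero, it never comes back. -/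
theorem convex_step (r : ℕ) (b ff d : ℕ → ℤ) (c : ℤ) (hc : c < 0)
    (hb : ∀ t, 1 ≤ t → t ≤ r → 2 ≤ b t)
    (hS : ∀ k u : ℕ, 1 ≤ u → u + k ≤ r + 1 →
      (∑ j ∈ Finset.range k, (ff (u + j) - (b (u + j) - 2))) ≤ 1)
    (hd : ∀ t, t ≤ r + 1 → 0 ≤ d t)
    (hG : ∀ t, 1 ≤ t → t ≤ r →
      0 ≤ d (t - 1) - b t * d t + d (t + 1) + ff t + (b t - 2) * c)
    (z : ℕ) (hz : d z = 0) (hz1 : 1 ≤ d (z + 1)) :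
    ∀ k, z + 1 + k ≤ r + 1 → 1 ≤ d (z + 1 + k) := by
  have slope : ∀ k, z + 1 + k ≤ r + 1 →
      1 - (∑ j ∈ Finset.range k, (ff (z + 1 + j) - (b (z + 1 + j) - 2)))
        ≤ d (z + 1 + k) - d (z + k) := by
    intro k
    induction k with
    | zero => intro _; simp; omega
    | succ k ih =>
      intro hk
      have h1 := ih (by omega)
      have h2 := hG (z + 1 + k) (by omega) (by omega)
      have h3 := hb (z + 1 + k) (by omega) (by omega)
      have h4 := hd (z + 1 + k) (by omega)
      rw [Finset.sum_range_succ]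
      rw [show z + 1 + k - 1 = z + k by omega] at h2
      rw [show z + 1 + (k + 1) = z + 1 + k + 1 by omega, show z + (k + 1) = z + 1 + k by omega]
      nlinarith [mul_nonneg (show 0 ≤ b (z + 1 + k) - 2 by omega)
        (show 0 ≤ d (z + 1 + k) - c - 1 by omega)]
  intro k
  induction k with
  | zero => intro _; exact hz1
  | succ k ih =>
    intro hk
    have h1 := ih (by omega)
    have h2 := slope (k + 1) hk
    have h3 := hS (k + 1) (z + 1) (by omega) (by omega)
    rw [show z + (k + 1) = z + 1 + k by omega] at h2
    omega

set_option maxHeartbeats 2000000 in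
/-- Existence of a solution with right-hand side δ_{ts} − f_t − (b_t−2)c. -/
theorem stmt_11
    (n q : ℤ) (r : ℕ)
    (hq : 0 < q) (hqn : q < n) (hcop : IsCoprime q n)
    (hr : 1 ≤ r)
    (i b : ℕ → ℤ)
    (hi0 : i 0 = n) (hi1 : i 1 = q)
    (hrec : ∀ t, 1 ≤ t → t ≤ r → i (t - 1) = b t * i t - i (t + 1))
    (hlt : ∀ t, 1 ≤ t → t ≤ r → 0 ≤ i (t + 1) ∧ i (t + 1) < i t)
    (hir : i r = 1) (hir1 : i (r + 1) = 0)
    -- f, g and their Wunram expansions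
    (f g : ℤ) (hf0 : 0 ≤ f) (hfn : f ≤ n - 1) (hg0 : 0 ≤ g) (hgn : g ≤ n - 1)
    (ff : ℕ → ℤ)
    (hffnn : ∀ t, 1 ≤ t → t ≤ r → 0 ≤ ff t)
    (hfsum : f = ∑ t ∈ Finset.Icc 1 r, ff t * i t)
    (hftail : ∀ t0, t0 ≤ r →
      0 ≤ ∑ t ∈ Finset.Icc (t0 + 1) r, ff t * i t ∧
      ∑ t ∈ Finset.Icc (t0 + 1) r, ff t * i t < i t0)
    (gg : ℕ → ℤ)
    (hggnn : ∀ t, 1 ≤ t → t ≤ r → 0 ≤ gg t)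
    (hgsum : g = ∑ t ∈ Finset.Icc 1 r, gg t * i t)
    (hgtail : ∀ t0, t0 ≤ r →
      0 ≤ ∑ t ∈ Finset.Icc (t0 + 1) r, gg t * i t ∧
      ∑ t ∈ Finset.Icc (t0 + 1) r, gg t * i t < i t0)
    -- a ≥ 0, b ≥ 0, c < 0 and existence of a nonnegative solution of the system
    (a bb c : ℤ) (ha : 0 ≤ a) (hbb : 0 ≤ bb) (hc : c < 0)
    (he : ∃ e : ℕ → ℤ,
      e 0 = bb ∧ e (r + 1) = a ∧
      (∀ t, 1 ≤ t → t ≤ r → 0 ≤ e t) ∧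
      (∀ t, 1 ≤ t → t ≤ r →
        e (t - 1) - b t * e t + e (t + 1) = gg t - ff t - (b t - 2) * c)) :
    ∃ s, s ≤ r ∧ ∃ a' b' : ℤ, 0 ≤ a' ∧ a' ≤ a ∧ 0 ≤ b' ∧ b' ≤ bb ∧
      ∃ h : ℕ → ℤ,
        h 0 = b' ∧ h (r + 1) = a' ∧
        (∀ t, 1 ≤ t → t ≤ r → 0 ≤ h t) ∧
        (∀ t, 1 ≤ t → t ≤ r →
          h (t - 1) - b t * h t + h (t + 1) =
            (if t = s then 1 else 0) - ff t - (b t - 2) * c) := by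
  obtain ⟨e, he0, her, hen, heq⟩ := he
  have hpos : ∀ t, 1 ≤ t → t ≤ r → 1 ≤ i t := by
    intro t h1 h2
    have := hlt t h1 h2
    omega
  have hnn : ∀ t, 1 ≤ t → t ≤ r + 1 → 0 ≤ i t := by
    intro t h1 h2
    obtain ⟨u, rfl⟩ : ∃ u, t = u + 1 := ⟨t - 1, by omega⟩
    by_cases hu : u = 0
    · subst hu
      simp only [Nat.zero_add]
      omega
    · exact (hlt u (by omega) (by omega)).1
  have hdec : ∀ t, 1 ≤ t → t ≤ r → i t < i (t - 1) := by
    intro t h1 h2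
    by_cases hu : t = 1
    · subst hu
      simp only [Nat.sub_self]
      omega
    · have := (hlt (t - 1) (by omega) (by omega)).2
      rwa [show t - 1 + 1 = t by omega] at this
  have hb : ∀ t, 1 ≤ t → t ≤ r → 2 ≤ b t := by
    intro t h1 h2
    have a1 := hpos t h1 h2
    have a2 := hdec t h1 h2
    have a3 := hrec t h1 h2
    have a4 := hlt t h1 h2
    by_contra hcon
    have : b t ≤ 1 := by omega
    nlinarith
  have hS : ∀ k u : ℕ, 1 ≤ u → u + k ≤ r + 1 →
      (∑ j ∈ Finset.range k, (ff (u + j) - (b (u + j) - 2))) ≤ 1 := by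
    intro k u h1 h2
    refine (wunram_interval r i b ff (fun u => ∑ t ∈ Finset.Icc u r, ff t * i t)
      hpos hnn hrec ?_ ?_ ?_ k u h1 h2).1
    · intro t h1 h2
      have h3 := (Finset.add_sum_Ioc_eq_sum_Icc (f := fun t => ff t * i t) h2).symm
      rwa [show Finset.Ioc t r = Finset.Icc (t + 1) r by ext x; simp only [Finset.mem_Ioc, Finset.mem_Icc]; omega] at h3
    · intro t h1 h2
      have := (hftail (t - 1) (by omega)).1
      rwa [show t - 1 + 1 = t by omega] at this
    · intro t h1 h2
      have := (hftail (t - 1) (by omega)).2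
      rwa [show t - 1 + 1 = t by omega] at this
  -- a minimal admissible sequence
  let P : (ℕ → ℤ) → Prop := fun h => (∀ t, t ≤ r + 1 → 0 ≤ h t) ∧ h 0 ≤ bb ∧ h (r + 1) ≤ a ∧
    ∀ t, 1 ≤ t → t ≤ r → 0 ≤ h (t - 1) - b t * h t + h (t + 1) + ff t + (b t - 2) * c
  let M : (ℕ → ℤ) → ℕ := fun h => (∑ t ∈ Finset.range (r + 2), h t).toNat
  have hPe : P e := by
    refine ⟨?_, he0.le, her.le, ?_⟩
    · intro t ht
      by_cases h0 : t = 0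
      · subst h0; omega
      by_cases h1 : t = r + 1
      · subst h1; omega
      exact hen t (by omega) (by omega)
    · intro t h1 h2
      have := heq t h1 h2
      have := hggnn t h1 h2
      linarith
  obtain ⟨d, hPd, hmin⟩ : ∃ d, P d ∧ ∀ h, P h → M d ≤ M h := by
    have hex : ∃ m, ∃ h, P h ∧ M h = m := ⟨_, e, hPe, rfl⟩
    classical
    obtain ⟨d, h1, h2⟩ := Nat.find_spec hex
    exact ⟨d, h1, fun h hh => h2 ▸ Nat.find_min' hex ⟨h, hh, rfl⟩⟩
  have hmin' : ∀ h, P h → ∑ t ∈ Finset.range (r + 2), d t ≤ ∑ t ∈ Finset.range (r + 2), h t := by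
    intro h hh
    have h1 := hmin h hh
    have h2 : 0 ≤ ∑ t ∈ Finset.range (r + 2), h t :=
      Finset.sum_nonneg fun t ht => hh.1 t (by have := Finset.mem_range.1 ht; omega)
    simp only [M] at h1
    omega
  obtain ⟨hd, hd0, hdr, hG⟩ := hPd
  have left0 : ∀ p, 1 ≤ p → p ≤ r →
      1 ≤ d (p - 1) - b p * d p + d (p + 1) + ff p + (b p - 2) * c → ∃ t, t < p ∧ d t = 0 := by
    intro p h1 h2 hp
    by_contra! hcon
    have hpd : ∀ t, t < p → 1 ≤ d t := by
      intro t ht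
      have := hcon t ht
      have := hd t (by omega)
      omega
    have := hmin' (fun t => if t < p then d t - 1 else d t) (by
      refine ⟨?_, ?_, ?_, ?_⟩
      · intro t ht
        have := hd t ht
        have := hpd t
        dsimp only
        split_ifs with h
        · have := hpd t h
          omega
        · omega
      · dsimp only
        split_ifs <;> omega
      · dsimp only
        split_ifs <;> omega
      · intro t t1 t2
        have g := hG t t1 t2
        have bt := hb t t1 t2
        dsimp only
        rcases lt_trichotomy t p with h | h | h
        · rw [if_pos (by omega), if_pos h]
          split_ifs <;> nlinarith
        · subst h
          rw [if_pos (by omega), if_neg (by omega), if_neg (by omega)]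
          linarith
        · rw [if_neg (by omega), if_neg (by omega), if_neg (by omega)]
          exact g)
    refine absurd this (not_le.2 (Finset.sum_lt_sum ?_ ⟨0, by simp, ?_⟩))
    · intro t _
      split_ifs <;> omega
    · rw [if_pos (by omega)]
      omega
  have right0 : ∀ p, 1 ≤ p → p ≤ r →
      1 ≤ d (p - 1) - b p * d p + d (p + 1) + ff p + (b p - 2) * c →
      ∃ t, p < t ∧ t ≤ r + 1 ∧ d t = 0 := by
    intro p h1 h2 hp
    by_contra! hcon
    have hpd : ∀ t, p < t → t ≤ r + 1 → 1 ≤ d t := by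
      intro t ht ht'
      have := hcon t ht ht'
      have := hd t (by omega)
      omega
    have := hmin' (fun t => if p < t then d t - 1 else d t) (by
      refine ⟨?_, ?_, ?_, ?_⟩
      · intro t ht
        have := hd t ht
        dsimp only
        split_ifs with h
        · have := hpd t h ht
          omega
        · omega
      · dsimp only
        split_ifs <;> omega
      · dsimp only
        split_ifs <;> omega
      · intro t t1 t2
        have g := hG t t1 t2
        have bt := hb t t1 t2
        dsimp only
        rcases lt_trichotomy t p with h | h | h
        · rw [if_neg (by omega), if_neg (by omega), if_neg (by omega)]
          exact g
        · subst h
          rw [if_neg (by omega), if_neg (by omega), if_pos (by omega)]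
          linarith
        · rw [if_pos h, if_pos (show p < t + 1 by omega)]
          split_ifs <;> nlinarith)
    refine absurd this (not_le.2 (Finset.sum_lt_sum ?_ ⟨r + 1, by simp, ?_⟩))
    · intro t _
      split_ifs <;> omega
    · rw [if_pos (by omega)]
      omega
  have zeros : ∀ t0 t1, t1 ≤ r + 1 → d t0 = 0 → d t1 = 0 → ∀ k, t0 + k ≤ t1 → d (t0 + k) = 0 := by
    intro t0 t1 h1 z0 z1 k
    induction k with
    | zero => intro _; exact z0
    | succ k ih =>
      intro hk
      have hz := ih (by omega)
      by_contra hne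
      have := hd (t0 + (k + 1)) (by omega)
      have h2 := convex_step r b ff d c hc hb hS hd hG (t0 + k) hz
        (by rw [Nat.add_assoc]; omega) (t1 - (t0 + k + 1)) (by omega)
      rw [show t0 + k + 1 + (t1 - (t0 + k + 1)) = t1 by omega] at h2
      omega
  have key : ∀ p p', 1 ≤ p → p ≤ p' → p' ≤ r →
      1 ≤ d (p - 1) - b p * d p + d (p + 1) + ff p + (b p - 2) * c →
      1 ≤ d (p' - 1) - b p' * d p' + d (p' + 1) + ff p' + (b p' - 2) * c →
      ∀ t, p ≤ t → t ≤ p' →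
        d (t - 1) - b t * d t + d (t + 1) + ff t + (b t - 2) * c ≤ ff t - (b t - 2) := by
    intro p p' h1 h2 h3 g g' t ht ht'
    obtain ⟨t0, l0, z0⟩ := left0 p h1 (by omega) g
    obtain ⟨t1, l1, l2, z1⟩ := right0 p' (by omega) h3 g'
    have zz : ∀ x, t0 ≤ x → x ≤ t1 → d x = 0 := by
      intro x hx hx'
      have := zeros t0 t1 l2 z0 z1 (x - t0) (by omega)
      rwa [show t0 + (x - t0) = x by omega] at this
    rw [zz (t - 1) (by omega) (by omega), zz t (by omega) (by omega),
      zz (t + 1) (by omega) (by omega)]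
    have := hb t (by omega) (by omega)
    nlinarith
  have two : ∀ p p', 1 ≤ p → p < p' → p' ≤ r →
      1 ≤ d (p - 1) - b p * d p + d (p + 1) + ff p + (b p - 2) * c →
      1 ≤ d (p' - 1) - b p' * d p' + d (p' + 1) + ff p' + (b p' - 2) * c → False := by
    intro p p' h1 h2 h3 g g'
    have kk := key p p' h1 h2.le h3 g g'
    have k1 := kk p le_rfl h2.le
    have k2 := kk p' h2.le le_rfl
    obtain ⟨m, rfl⟩ : ∃ m, p' = p + (m + 1) := ⟨p' - p - 1, by omega⟩
    have s := hS (m + 1 + 1) p h1 (by omega)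
    rw [Finset.sum_range_succ, Finset.sum_range_succ', Nat.add_zero] at s
    have : 0 ≤ ∑ j ∈ Finset.range m, (ff (p + (j + 1)) - (b (p + (j + 1)) - 2)) := by
      refine Finset.sum_nonneg fun j hj => ?_
      have hj := Finset.mem_range.1 hj
      exact (hG (p + (j + 1)) (by omega) (by omega)).trans
        (kk (p + (j + 1)) (by omega) (by omega))
    linarith
  by_cases hall : ∃ p, 1 ≤ p ∧ p ≤ r ∧
      1 ≤ d (p - 1) - b p * d p + d (p + 1) + ff p + (b p - 2) * c
  · obtain ⟨p, h1, h2, g⟩ := hall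
    refine ⟨p, h2, d (r + 1), d 0, hd _ le_rfl, hdr, hd _ (by omega), hd0, d, rfl, rfl,
      fun t _ _ => hd t (by omega), ?_⟩
    intro t t1 t2
    have gt := hG t t1 t2
    split_ifs with h
    · subst h
      have k1 := key t t t1 le_rfl t2 g g t le_rfl le_rfl
      have s := hS 1 t t1 (by omega)
      rw [Finset.sum_range_one, Nat.add_zero] at s
      linarith
    · have : ¬ 1 ≤ d (t - 1) - b t * d t + d (t + 1) + ff t + (b t - 2) * c := by
        intro g'
        rcases lt_or_gt_of_ne h with h | h
        · exact two t p t1 h h2 g' g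
        · exact two p t h1 h t2 g g'
      have : d (t - 1) - b t * d t + d (t + 1) + ff t + (b t - 2) * c ≤ 0 := by
        by_contra hx
        exact this (by linarith [Int.add_one_le_of_lt (not_le.1 hx)])
      linarith
  · refine ⟨0, by omega, d (r + 1), d 0, hd _ le_rfl, hdr, hd _ (by omega), hd0, d, rfl, rfl,
      fun t _ _ => hd t (by omega), ?_⟩
    intro t t1 t2
    have gt := hG t t1 t2
    rw [if_neg (by omega)]
    have : d (t - 1) - b t * d t + d (t + 1) + ff t + (b t - 2) * c ≤ 0 := by
      by_contra hx
      exact hall ⟨t, t1, t2, by linarith [Int.add_one_le_of_lt (not_le.1 hx)]⟩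
    linarith
end

section
/- For every integer d with 0 ≤ d < n there exists a unique sequence (d_1, …, d_r) of non-negative integers such that d = Σ_{t=1}^r d_t·j_t and, for every t_0 ∈ {1, …, r+1}, 0 ≤ Σ_{t<t_0} d_t·j_t < j_{t_0}. -/
theorem aux_unique (j : ℕ → ℤ) (x y : ℕ → ℤ) (m : ℕ)
    (hx : ∀ t0, 1 ≤ t0 → t0 ≤ m + 1 → 0 ≤ ∑ t ∈ Finset.Ico 1 t0, x t * j t ∧
          ∑ t ∈ Finset.Ico 1 t0, x t * j t < j t0)
    (hy : ∀ t0, 1 ≤ t0 → t0 ≤ m + 1 → 0 ≤ ∑ t ∈ Finset.Ico 1 t0, y t * j t ∧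
          ∑ t ∈ Finset.Ico 1 t0, y t * j t < j t0)
    (h : ∑ t ∈ Finset.Ico 1 (m + 1), x t * j t = ∑ t ∈ Finset.Ico 1 (m + 1), y t * j t) :
    ∀ t, 1 ≤ t → t ≤ m → x t = y t := by
  induction m with
  | zero => intro t h1 h2; omega
  | succ m ih =>
    have hxm := hx (m + 1) (by omega) (by omega)
    have hym := hy (m + 1) (by omega) (by omega)
    have hle : 1 ≤ m + 1 := by omega
    rw [Finset.sum_Ico_succ_top hle (fun t => x t * j t),
      Finset.sum_Ico_succ_top hle (fun t => y t * j t)] at h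
    have hpos : 0 < j (m + 1) := by linarith
    have key : x (m + 1) = y (m + 1) := by
      rcases lt_trichotomy (x (m + 1)) (y (m + 1)) with hl | hl | hl
      · nlinarith
      · exact hl
      · nlinarith
    rw [key] at h
    intro t h1 h2
    rcases Nat.lt_or_ge m t with h3 | h3
    · have : t = m + 1 := by omega
      rw [this, key]
    · exact ih (fun t0 a b => hx t0 a (by omega)) (fun t0 a b => hy t0 a (by omega))
        (by linarith) t h1 h3

theorem aux_exists (j : ℕ → ℤ) (m : ℕ) (hj1 : j 1 = 1)
    (hj : ∀ t, 1 ≤ t → t ≤ m + 1 → 0 < j t) : ∀ d : ℤ, 0 ≤ d → d < j (m + 1) →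
    ∃ x : ℕ → ℤ, (∀ t, t = 0 ∨ m < t → x t = 0) ∧ (∀ t, 1 ≤ t → t ≤ m → 0 ≤ x t) ∧
      d = ∑ t ∈ Finset.Ico 1 (m + 1), x t * j t ∧
      (∀ t0, 1 ≤ t0 → t0 ≤ m + 1 → 0 ≤ ∑ t ∈ Finset.Ico 1 t0, x t * j t ∧
          ∑ t ∈ Finset.Ico 1 t0, x t * j t < j t0) := by
  induction m with
  | zero =>
    intro d h0 h1
    refine ⟨fun _ => 0, by simp, by simp, ?_, ?_⟩
    · simp at h1 ⊢; omega
    · intro t0 a b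
      have : t0 = 1 := by omega
      subst this; simp [hj1]
  | succ m ih =>
    intro d h0 h1
    have hp := hj (m + 1) (by omega) (by omega)
    obtain ⟨x, hx0, hx1, hx2, hx3⟩ := ih (fun t a b => hj t a (by omega)) (d % j (m + 1))
      (Int.emod_nonneg _ hp.ne') (Int.emod_lt_of_pos _ hp)
    have hs : ∀ t0, t0 ≤ m + 1 →
        ∑ t ∈ Finset.Ico 1 t0, Function.update x (m + 1) (d / j (m + 1)) t * j t
          = ∑ t ∈ Finset.Ico 1 t0, x t * j t := by
      intro t0 ht
      apply Finset.sum_congr rfl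
      intro t h
      rw [Finset.mem_Ico] at h
      rw [Function.update_of_ne (by omega)]
    have htot : d = ∑ t ∈ Finset.Ico 1 (m + 1 + 1),
        Function.update x (m + 1) (d / j (m + 1)) t * j t := by
      rw [Finset.sum_Ico_succ_top (by omega), hs _ le_rfl, ← hx2, Function.update_self]
      linarith [Int.emod_add_mul_ediv d (j (m + 1)), mul_comm (d / j (m + 1)) (j (m + 1))]
    refine ⟨Function.update x (m + 1) (d / j (m + 1)), ?_, ?_, htot, ?_⟩
    · intro t ht
      rw [Function.update_of_ne (by omega)]
      exact hx0 t (by omega)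
    · intro t a b
      rcases eq_or_ne t (m + 1) with rfl | h
      · rw [Function.update_self]; exact Int.ediv_nonneg h0 hp.le
      · rw [Function.update_of_ne h]; exact hx1 t a (by omega)
    · intro t0 a b
      rcases Nat.lt_or_ge (m + 1) t0 with h | h
      · have : t0 = m + 1 + 1 := by omega
        subst this
        rw [← htot]; exact ⟨h0, h1⟩
      · rw [hs t0 h]; exact hx3 t0 a h


/-- Existence and uniqueness of the dual Wunram expansion. -/
theorem stmt_14
    (n q : ℤ) (r : ℕ)
    (hq : 0 < q) (hqn : q < n) (hcop : IsCoprime q n)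
    (hr : 1 ≤ r)
    (i b : ℕ → ℤ)
    (hi0 : i 0 = n) (hi1 : i 1 = q)
    (hrec : ∀ t, 1 ≤ t → t ≤ r → i (t - 1) = b t * i t - i (t + 1))
    (hlt : ∀ t, 1 ≤ t → t ≤ r → 0 ≤ i (t + 1) ∧ i (t + 1) < i t)
    (hir : i r = 1) (hir1 : i (r + 1) = 0)
    (j : ℕ → ℤ) (hj0 : j 0 = 0) (hj1 : j 1 = 1)
    (hjrec : ∀ t, 1 ≤ t → t ≤ r → j (t + 1) = b t * j t - j (t - 1)) :
    ∀ d : ℤ, 0 ≤ d → d < n →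
      ∃! dd : ℕ → ℤ,
        (∀ t, t = 0 ∨ r < t → dd t = 0) ∧
        (∀ t, 1 ≤ t → t ≤ r → 0 ≤ dd t) ∧
        d = ∑ t ∈ Finset.Icc 1 r, dd t * j t ∧
        (∀ t0, 1 ≤ t0 → t0 ≤ r + 1 →
          0 ≤ ∑ t ∈ Finset.Ico 1 t0, dd t * j t ∧
          ∑ t ∈ Finset.Ico 1 t0, dd t * j t < j t0) := by
  have hipos : ∀ t, 1 ≤ t → t ≤ r → 0 < i t := fun t a b => by
    have := hlt t a b; linarith
  have hdec : ∀ t, t ≤ r → i (t + 1) < i t := by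
    intro t ht
    rcases Nat.eq_zero_or_pos t with rfl | h
    · simpa [hi0, hi1] using hqn
    · exact (hlt t h ht).2
  have hb : ∀ t, t + 1 ≤ r → 2 ≤ b (t + 1) := by
    intro t ht
    have h1 := hrec (t + 1) (by omega) ht
    have h2 := hlt (t + 1) (by omega) ht
    have h3 := hdec t (by omega)
    have h4 := hipos (t + 1) (by omega) ht
    simp only [Nat.add_sub_cancel] at h1
    by_contra hc
    have : b (t + 1) ≤ 1 := by omega
    nlinarith
  have hmain : ∀ t, t ≤ r → 0 ≤ j t ∧ j t < j (t + 1) ∧ i t * j (t + 1) - i (t + 1) * j t = n := by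
    intro t
    induction t with
    | zero => intro _; simp [hj0, hj1, hi0]
    | succ t ih =>
      intro ht
      obtain ⟨h1, h2, h3⟩ := ih (by omega)
      have h4 := hjrec (t + 1) (by omega) ht
      have h5 := hrec (t + 1) (by omega) ht
      have h6 := hb t ht
      simp only [Nat.add_sub_cancel] at h4 h5
      refine ⟨by linarith, by nlinarith, ?_⟩
      rw [h4, ← h3, h5]; ring
  have hjpos : ∀ t, 1 ≤ t → t ≤ r + 1 → 0 < j t := by
    intro t a b
    obtain ⟨s, rfl⟩ : ∃ s, t = s + 1 := ⟨t - 1, by omega⟩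
    have := hmain s (by omega)
    linarith
  have hn : j (r + 1) = n := by
    have := (hmain r le_rfl).2.2
    rw [hir, hir1] at this; linarith
  intro d hd0 hdn
  have hI : Finset.Icc 1 r = Finset.Ico 1 (r + 1) := by
    ext t; simp only [Finset.mem_Icc, Finset.mem_Ico]; omega
  rw [hI]
  obtain ⟨x, hx0, hx1, hx2, hx3⟩ := aux_exists j r hj1 hjpos d hd0 (by rw [hn]; exact hdn)
  refine ⟨x, ⟨hx0, hx1, hx2, hx3⟩, ?_⟩
  rintro y ⟨hy0, hy1, hy2, hy3⟩
  funext t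
  by_cases h : t = 0 ∨ r < t
  · rw [hy0 t h, hx0 t h]
  · exact aux_unique j y x r hy3 hx3 (hy2.symm.trans hx2) t (by omega) (by omega)
end
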